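/- arXiv:math/0612040 — 2 statements merged into one kernel-verified Lean document; each statement's English description precedes it below -/
import Mathlib

section
/- Let X be a real random variable, and let F, U : ℝ → ℝ be measurable with μ := E[F(X)] and ν := E[U(X)] finite. Suppose m(β) := ess sup[F(X) − β·U(X)] < ∞ for all β > 0. Then for every ε > 0 and u > 0, the rate function Λ₊*(ε,u) := sup_{θ₁ ≥ 0, θ₂ ≥ 0} [θ₁(μ + ε) − θ₂(ν + u) − log E[exp(θ₁ F(X) − θ₂ U(X))]] is strictly positive. -/
open MeasureTheory ProbabilityTheory Real Filter
open scoped ENNReal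

-- The Fenchel–Legendre rate function Λ₊*(ε,u), where
-- Λ₊(θ₁,θ₂) := log E[exp(θ₁F(X) − θ₂U(X))] (possibly +∞), computed as EReal.
noncomputable def LambdaPlusStar {Ω : Type*} [MeasurableSpace Ω] (Pr : Measure Ω)
    (Y : Ω → ℝ) (F U : ℝ → ℝ) (μ ν ε u : ℝ) : EReal :=
  ⨆ θ₁ : ℝ, ⨆ (_ : 0 ≤ θ₁), ⨆ θ₂ : ℝ, ⨆ (_ : 0 ≤ θ₂),
    (((θ₁ * (μ + ε) - θ₂ * (ν + u) : ℝ) : EReal) -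
      ENNReal.log (∫⁻ ω, ENNReal.ofReal (Real.exp (θ₁ * F (Y ω) - θ₂ * U (Y ω))) ∂Pr))

/-- If `Z` is integrable and almost surely bounded above, its exponential moments satisfy
`E[exp (t Z)] < exp (t (E[Z] + δ))` for some small `t > 0`. -/
theorem exists_lintegral_exp_lt {Ω : Type*} [MeasurableSpace Ω] {P : Measure Ω}
    [IsProbabilityMeasure P] {Z : Ω → ℝ} (hZ : Integrable Z P) {c : ℝ}
    (hc : ∀ᵐ ω ∂P, Z ω ≤ c) {δ : ℝ} (hδ : 0 < δ) :
    ∃ t : ℝ, 0 < t ∧ ∫⁻ ω, ENNReal.ofReal (Real.exp (t * Z ω)) ∂P <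
      ENNReal.ofReal (Real.exp (t * (∫ ω, Z ω ∂P + δ))) := by
  set a : ℝ := ∫ ω, Z ω ∂P + δ with ha
  let W : Ω → ℝ := fun ω => Z ω - a
  have hW : Integrable W P := hZ.sub (integrable_const a)
  have hWint : ∫ ω, W ω ∂P = -δ := by
    simp only [W]
    rw [integral_sub hZ (integrable_const a)]
    simp [ha]
  let K : ℝ := max (c - a) 0
  have hslope : ∀ t : ℝ, 0 < t → t ≤ 1 → ∀ x : ℝ, x ≤ K →
      |t⁻¹ * (Real.exp (t * x) - 1)| ≤ Real.exp K * |x| := by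
    intro t ht ht1 x hx
    have hK : 0 ≤ K := le_max_right _ _
    have hmono : Real.exp (t * x) ≤ Real.exp K := Real.exp_le_exp.2 (by nlinarith)
    have hK1 : 1 ≤ Real.exp K := Real.one_le_exp hK
    have h1 := Real.add_one_le_exp (t * x)
    have h2 : Real.exp (t * x) - 1 ≤ Real.exp (t * x) * (t * x) := by
      have := Real.add_one_le_exp (-(t * x))
      have h3 : Real.exp (t * x) * Real.exp (-(t * x)) = 1 := by
        rw [← Real.exp_add]; simp
      nlinarith [Real.exp_pos (t * x)]
    have h4 : |Real.exp (t * x) - 1| ≤ Real.exp K * |t * x| := by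
      have hx1 := neg_abs_le (t * x)
      have hx2 := le_abs_self (t * x)
      have hx3 := abs_nonneg (t * x)
      rw [abs_le]
      constructor
      · nlinarith
      · nlinarith [Real.exp_pos (t * x)]
    rw [abs_mul, abs_of_pos (inv_pos.2 ht)]
    rw [abs_mul, abs_of_pos ht] at h4
    rw [inv_mul_le_iff₀ ht]
    linarith
  have hlim : Tendsto (fun t : ℝ => ∫ ω, t⁻¹ * (Real.exp (t * W ω) - 1) ∂P)
      (nhdsWithin 0 (Set.Ioi 0)) (nhds (∫ ω, W ω ∂P)) := by
    refine tendsto_integral_filter_of_dominated_convergence (fun ω => Real.exp K * |W ω|) ?_ ?_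
      (hW.abs.const_mul _) ?_
    · refine Eventually.of_forall fun t => ?_
      exact ((Real.continuous_exp.comp_aestronglyMeasurable
        (hW.aestronglyMeasurable.const_mul t)).sub aestronglyMeasurable_const).const_mul _
    · filter_upwards [Ioc_mem_nhdsGT (zero_lt_one' ℝ)] with t ht
      filter_upwards [hc] with ω hω
      exact hslope t ht.1 ht.2 _ (le_max_of_le_left (by simp only [W]; linarith))
    · refine Eventually.of_forall fun ω => ?_
      have hd : HasDerivAt (fun t : ℝ => Real.exp (t * W ω)) (W ω) 0 := by
        simpa using ((hasDerivAt_id (0 : ℝ)).mul_const (W ω)).exp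
      have := hd.tendsto_slope_zero_right
      simpa using this
  rw [hWint] at hlim
  obtain ⟨t, hneg, ht⟩ := ((hlim.eventually_lt_const (neg_lt_zero.2 hδ)).and
    self_mem_nhdsWithin).exists
  have ht : 0 < t := ht
  have hexp : Integrable (fun ω => Real.exp (t * Z ω)) P := by
    refine Integrable.of_bound (C := Real.exp (t * c))
      (Real.continuous_exp.comp_aestronglyMeasurable
        (hZ.aestronglyMeasurable.const_mul t)) ?_
    filter_upwards [hc] with ω hω
    rw [Real.norm_eq_abs, Real.abs_exp]
    gcongr
  refine ⟨t, ht, ?_⟩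
  rw [← ofReal_integral_eq_lintegral_ofReal hexp (ae_of_all _ fun ω => (Real.exp_pos _).le),
    ENNReal.ofReal_lt_ofReal_iff (Real.exp_pos _)]
  have hsplit : (fun ω => Real.exp (t * W ω)) =
      fun ω => Real.exp (t * Z ω) * (Real.exp (t * a))⁻¹ := by
    funext ω
    rw [← Real.exp_neg, ← Real.exp_add]
    simp only [W]
    ring_nf
  have hWexp : Integrable (fun ω => Real.exp (t * W ω)) P := by
    rw [hsplit]
    exact hexp.mul_const _
  rw [integral_const_mul, integral_sub hWexp (integrable_const 1), hsplit,
    integral_mul_const] at hneg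
  have hneg' := neg_of_mul_neg_right hneg (inv_pos.2 ht).le
  simp only [integral_const, probReal_univ, smul_eq_mul, mul_one, sub_neg] at hneg'
  rwa [← div_eq_mul_inv, div_lt_one (Real.exp_pos _)] at hneg'

/-- Theorem 2.2(iii): under the domination condition, the rate function
`Λ₊*(ε,u)` is strictly positive for every `ε, u > 0`. -/
theorem rate_function_strictly_positive
    {Ω : Type*} [MeasurableSpace Ω] (Pr : Measure Ω) [IsProbabilityMeasure Pr]
    (X : Ω → ℝ) (hXmeas : Measurable X)
    (F U : ℝ → ℝ) (hF : Measurable F) (hU : Measurable U)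
    (μ ν : ℝ)
    (hFint : Integrable (fun ω => F (X ω)) Pr) (hμ : ∫ ω, F (X ω) ∂Pr = μ)
    (hUint : Integrable (fun ω => U (X ω)) Pr) (hν : ∫ ω, U (X ω) ∂Pr = ν)
    (hdom : ∀ β : ℝ, 0 < β → ∃ c : ℝ, ∀ᵐ ω ∂Pr, F (X ω) - β * U (X ω) ≤ c)
    (ε u : ℝ) (hε : 0 < ε) (hu : 0 < u) :
    0 < LambdaPlusStar Pr X F U μ ν ε u := by
  obtain ⟨c, hc⟩ := hdom (ε / (2 * u)) (by positivity)
  obtain ⟨t, ht, hlt⟩ := exists_lintegral_exp_lt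
    (hFint.sub (hUint.const_mul (ε / (2 * u)))) hc (half_pos hε)
  have hmean : ∫ ω, ((fun ω => F (X ω)) - fun ω => ε / (2 * u) * U (X ω)) ω ∂Pr =
      μ - ε / (2 * u) * ν := by
    rw [integral_sub' hFint (hUint.const_mul _), integral_const_mul, hμ, hν]
  have ha : t * (μ - ε / (2 * u) * ν + ε / 2) =
      t * (μ + ε) - t * (ε / (2 * u)) * (ν + u) := by
    field_simp
    ring
  rw [hmean, ha] at hlt
  have hlog := ENNReal.log_lt_log hlt
  rw [ENNReal.log_ofReal_of_pos (Real.exp_pos _), Real.log_exp] at hlog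
  unfold LambdaPlusStar
  refine lt_of_lt_of_le ?_ (le_iSup₂_of_le t ht.le
    (le_iSup₂_of_le (t * (ε / (2 * u))) (by positivity) le_rfl))
  rw [EReal.sub_pos]
  simpa only [Pi.sub_apply, mul_sub, mul_assoc] using hlog
end

section
/- Let X be a real random variable and let F, U : ℝ → ℝ be measurable with E[F(X)] = E[U(X)] = 0, E[exp(θ·F(X))] < ∞ and E[exp(θ·U(X))] < ∞ for all θ ∈ ℝ, and with γ := Cov(F(X), U(X)) ≠ 0. Define Λ*(ε) := sup_{θ ≥ 0}[θε − log E[exp(θF(X))]], Λ₊*(ε,u) := sup_{θ₁,θ₂ ≥ 0}[θ₁ε − θ₂u − log E[exp(θ₁F(X) − θ₂U(X))]], Γ₊*(ε,u) := sup_{θ₁,θ₂ ≥ 0}[θ₁ε − θ₂u − log E[exp(θ₁F(X) + θ₂U(X))]], and Δ(ε,u) := max{Λ₊*(ε,u), Γ₊*(ε,u)} − Λ*(ε). Then there exists ε₀ > 0 such that for each 0 < ε < ε₀ there exists u₀ = u₀(ε) > 0 such that Δ(ε,u) > 0 for all u ∈ (0, u₀). -/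
open MeasureTheory ProbabilityTheory Real Filter
open scoped ENNReal

-- Cramér exponent Λ*(ε) := sup_{θ ≥ 0}[θε − log E exp(θF(X))], as an EReal.
noncomputable def cramerStar {Ω : Type*} [MeasurableSpace Ω] (Pr : Measure Ω)
    (Y : Ω → ℝ) (F : ℝ → ℝ) (ε : ℝ) : EReal :=
  ⨆ θ : ℝ, ⨆ (_ : 0 ≤ θ),
    (((θ * ε : ℝ) : EReal) -
      ENNReal.log (∫⁻ ω, ENNReal.ofReal (Real.exp (θ * F (Y ω))) ∂Pr))

-- Λ₊*(ε,u) := sup_{θ₁,θ₂ ≥ 0}[θ₁ε − θ₂u − log E exp(θ₁F(X) − θ₂U(X))].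
noncomputable def lambdaPlusStar {Ω : Type*} [MeasurableSpace Ω] (Pr : Measure Ω)
    (Y : Ω → ℝ) (F U : ℝ → ℝ) (ε u : ℝ) : EReal :=
  ⨆ θ₁ : ℝ, ⨆ (_ : 0 ≤ θ₁), ⨆ θ₂ : ℝ, ⨆ (_ : 0 ≤ θ₂),
    (((θ₁ * ε - θ₂ * u : ℝ) : EReal) -
      ENNReal.log (∫⁻ ω, ENNReal.ofReal (Real.exp (θ₁ * F (Y ω) - θ₂ * U (Y ω))) ∂Pr))

-- Γ₊*(ε,u) := sup_{θ₁,θ₂ ≥ 0}[θ₁ε − θ₂u − log E exp(θ₁F(X) + θ₂U(X))].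
noncomputable def gammaPlusStar {Ω : Type*} [MeasurableSpace Ω] (Pr : Measure Ω)
    (Y : Ω → ℝ) (F U : ℝ → ℝ) (ε u : ℝ) : EReal :=
  ⨆ θ₁ : ℝ, ⨆ (_ : 0 ≤ θ₁), ⨆ θ₂ : ℝ, ⨆ (_ : 0 ≤ θ₂),
    (((θ₁ * ε - θ₂ * u : ℝ) : EReal) -
      ENNReal.log (∫⁻ ω, ENNReal.ofReal (Real.exp (θ₁ * F (Y ω) + θ₂ * U (Y ω))) ∂Pr))

-- Δ(ε,u) := max{Λ₊*(ε,u), Γ₊*(ε,u)} − Λ*(ε).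
noncomputable def deltaExponent {Ω : Type*} [MeasurableSpace Ω] (Pr : Measure Ω)
    (Y : Ω → ℝ) (F U : ℝ → ℝ) (ε u : ℝ) : EReal :=
  max (lambdaPlusStar Pr Y F U ε u) (gammaPlusStar Pr Y F U ε u) -
    cramerStar Pr Y F ε

lemma integrable_exp_add_of_integrable_exp_two_mul {Ω : Type*} [MeasurableSpace Ω]
    {μ : Measure Ω} {a b : Ω → ℝ} (ha : Measurable a) (hb : Measurable b)
    (hai : Integrable (fun ω => Real.exp (2 * a ω)) μ)
    (hbi : Integrable (fun ω => Real.exp (2 * b ω)) μ) :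
    Integrable (fun ω => Real.exp (a ω + b ω)) μ := by
  refine (hai.add hbi).mono' (by fun_prop) (ae_of_all _ fun ω => ?_)
  rw [Real.norm_of_nonneg (Real.exp_pos _).le, Pi.add_apply, Real.exp_add, two_mul, two_mul,
    Real.exp_add, Real.exp_add]
  nlinarith [sq_nonneg (Real.exp (a ω) - Real.exp (b ω)), mul_self_nonneg (Real.exp (a ω)),
    mul_self_nonneg (Real.exp (b ω))]

lemma integrable_exp_mul_add_mul {Ω : Type*} [MeasurableSpace Ω] {μ : Measure Ω} {f g : Ω → ℝ}
    (hf : Measurable f) (hg : Measurable g)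
    (hfe : ∀ θ : ℝ, Integrable (fun ω => Real.exp (θ * f ω)) μ)
    (hge : ∀ θ : ℝ, Integrable (fun ω => Real.exp (θ * g ω)) μ) (s t : ℝ) :
    Integrable (fun ω => Real.exp (s * f ω + t * g ω)) μ := by
  refine integrable_exp_add_of_integrable_exp_two_mul (hf.const_mul s) (hg.const_mul t) ?_ ?_
  · simpa only [mul_assoc] using hfe (2 * s)
  · simpa only [mul_assoc] using hge (2 * t)

lemma hasDerivAt_integral_mul_exp_zero {Ω : Type*} [MeasurableSpace Ω] {μ : Measure Ω}
    {w v : Ω → ℝ} (hw : Measurable w) (hv : Measurable v) (hwi : Integrable w μ)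
    (hwv : Integrable (fun ω => |w ω| * Real.exp (2 * |v ω|)) μ) :
    HasDerivAt (fun t : ℝ => ∫ ω, w ω * Real.exp (t * v ω) ∂μ) (∫ ω, w ω * v ω ∂μ) 0 := by
  have key := (hasDerivAt_integral_of_dominated_loc_of_deriv_le (μ := μ) (x₀ := (0 : ℝ))
    (F := fun t ω => w ω * Real.exp (t * v ω))
    (F' := fun t ω => w ω * (Real.exp (t * v ω) * v ω))
    (Metric.ball_mem_nhds (0 : ℝ) one_pos)
    (Eventually.of_forall fun t => by fun_prop) (by simpa using hwi) (by fun_prop)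
    (ae_of_all _ fun ω t ht => ?_) hwv (ae_of_all _ fun ω t _ => ?_)).2
  · simpa using key
  · rw [mem_ball_zero_iff, Real.norm_eq_abs] at ht
    rw [norm_mul, norm_mul, Real.norm_eq_abs, Real.norm_eq_abs, Real.norm_eq_abs, Real.abs_exp]
    have h1 : Real.exp (t * v ω) ≤ Real.exp |v ω| := by
      refine Real.exp_le_exp.2 ((le_abs_self _).trans ?_)
      rw [abs_mul]
      exact mul_le_of_le_one_left (abs_nonneg _) ht.le
    have h2 : |v ω| ≤ Real.exp |v ω| := by linarith [Real.add_one_le_exp |v ω|]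
    rw [two_mul, Real.exp_add]
    gcongr
  · exact ((hasDerivAt_mul_const (v ω)).exp).const_mul (w ω)

lemma HasDerivAt.eventually_lt_of_neg {φ : ℝ → ℝ} {d x : ℝ} (h : HasDerivAt φ d x) (hd : d < 0) :
    ∀ᶠ t in nhdsWithin x (Set.Ioi x), φ t < φ x := by
  have hs := (hasDerivAt_iff_tendsto_slope.1 h).mono_left
    (nhdsWithin_mono x fun t (ht : x < t) => ht.ne')
  filter_upwards [hs.eventually_lt_const hd, self_mem_nhdsWithin] with t ht hxt
  have hxt : x < t := hxt
  rw [slope_def_field, div_lt_iff₀ (sub_pos.2 hxt)] at ht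
  linarith

lemma convexOn_integral_exp_mul {Ω : Type*} [MeasurableSpace Ω] {μ : Measure Ω} {f : Ω → ℝ}
    (hfe : ∀ θ : ℝ, Integrable (fun ω => Real.exp (θ * f ω)) μ) :
    ConvexOn ℝ Set.univ (fun θ : ℝ => ∫ ω, Real.exp (θ * f ω) ∂μ) := by
  refine ⟨convex_univ, fun x _ y _ a b ha hb hab => ?_⟩
  simp only [smul_eq_mul]
  rw [← integral_const_mul, ← integral_const_mul,
    ← integral_add ((hfe x).const_mul a) ((hfe y).const_mul b)]
  refine integral_mono (hfe _) (((hfe x).const_mul a).add ((hfe y).const_mul b)) fun ω => ?_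
  have := convexOn_exp.2 (Set.mem_univ (x * f ω)) (Set.mem_univ (y * f ω)) ha hb hab
  simp only [smul_eq_mul] at this
  convert this using 2
  ring

lemma ennreal_log_lintegral_exp {Ω : Type*} [MeasurableSpace Ω] {μ : Measure Ω} [NeZero μ]
    {a : Ω → ℝ} (ha : Integrable (fun ω => Real.exp (a ω)) μ) :
    ENNReal.log (∫⁻ ω, ENNReal.ofReal (Real.exp (a ω)) ∂μ) =
      ((Real.log (∫ ω, Real.exp (a ω) ∂μ) : ℝ) : EReal) := by
  rw [← ofReal_integral_eq_lintegral_ofReal ha (ae_of_all _ fun ω => (Real.exp_pos _).le),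
    ENNReal.log_ofReal_of_pos (integral_exp_pos ha)]

lemma one_lt_integral_exp_mul {Ω : Type*} [MeasurableSpace Ω] {μ : Measure Ω}
    [IsProbabilityMeasure μ] {f : Ω → ℝ} (hfi : Integrable f μ) (hf0 : ∫ ω, f ω ∂μ = 0)
    (hfne : ¬ f =ᵐ[μ] 0) {θ : ℝ} (hθ : θ ≠ 0)
    (hfe : Integrable (fun ω => Real.exp (θ * f ω)) μ) :
    1 < ∫ ω, Real.exp (θ * f ω) ∂μ := by
  have hlin : Integrable (fun ω => θ * f ω + 1) μ := (hfi.const_mul θ).add (integrable_const 1)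
  have hsub : ∫ ω, (Real.exp (θ * f ω) - (θ * f ω + 1)) ∂μ = ∫ ω, Real.exp (θ * f ω) ∂μ - 1 := by
    rw [integral_sub hfe hlin, integral_add (hfi.const_mul θ) (integrable_const 1),
      integral_const_mul, hf0]
    simp
  have hnn : 0 ≤ fun ω => Real.exp (θ * f ω) - (θ * f ω + 1) := fun ω =>
    sub_nonneg.2 (Real.add_one_le_exp _)
  rw [← sub_pos, ← hsub]
  refine (integral_nonneg hnn).lt_of_ne' fun h => hfne ?_
  filter_upwards [(integral_eq_zero_iff_of_nonneg hnn (hfe.sub hlin)).1 h] with ω hω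
  by_contra hne
  have := Real.add_one_lt_exp (mul_ne_zero hθ hne)
  simp only [Pi.zero_apply] at hω
  linarith

/-- If `f` is centred and nondegenerate, the Cramér supremum at a small level is attained at
some `θ` in `(0, δ)`. -/
lemma exists_isMinOn_integral_exp {Ω : Type*} [MeasurableSpace Ω] {μ : Measure Ω}
    [IsProbabilityMeasure μ] {f : Ω → ℝ} (hf : Measurable f) (hfi : Integrable f μ)
    (hf0 : ∫ ω, f ω ∂μ = 0) (hfne : ¬ f =ᵐ[μ] 0)
    (hfe : ∀ θ : ℝ, Integrable (fun ω => Real.exp (θ * f ω)) μ) {δ : ℝ} (hδ : 0 < δ) :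
    ∃ ε₀ : ℝ, 0 < ε₀ ∧ ∀ ε : ℝ, 0 < ε → ε < ε₀ → ∃ θ ∈ Set.Ioo 0 δ,
      ∀ η : ℝ, η * ε - Real.log (∫ ω, Real.exp (η * f ω) ∂μ) ≤
        θ * ε - Real.log (∫ ω, Real.exp (θ * f ω) ∂μ) := by
  have hM := one_lt_integral_exp_mul hfi hf0 hfne hδ.ne' (hfe δ)
  refine ⟨Real.log (∫ ω, Real.exp (δ * f ω) ∂μ) / δ, div_pos (Real.log_pos hM) hδ,
    fun ε hε hεlt => ?_⟩
  have hsplit : ∀ θ : ℝ, (fun ω => Real.exp (θ * (f ω - ε))) =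
      fun ω => Real.exp (-(θ * ε)) * Real.exp (θ * f ω) := fun θ => by
    ext ω
    rw [← Real.exp_add]
    ring_nf
  have hYe : ∀ θ : ℝ, Integrable (fun ω => Real.exp (θ * (f ω - ε))) μ := fun θ => by
    rw [hsplit]
    exact (hfe θ).const_mul _
  set H : ℝ → ℝ := fun θ => ∫ ω, Real.exp (θ * (f ω - ε)) ∂μ with hH
  have hlogH : ∀ θ, θ * ε - Real.log (∫ ω, Real.exp (θ * f ω) ∂μ) = - Real.log (H θ) :=
    fun θ => by
      have : H θ = Real.exp (-(θ * ε)) * ∫ ω, Real.exp (θ * f ω) ∂μ := by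
        simp only [hH, hsplit, integral_const_mul]
      rw [this, Real.log_mul (Real.exp_pos _).ne' (integral_exp_pos (hfe θ)).ne', Real.log_exp]
      ring
  have hH0 : H 0 = 1 := by simp [hH]
  have hHδ : 1 < H δ := by
    have h1 := hlogH δ
    rw [lt_div_iff₀ hδ] at hεlt
    exact (Real.log_pos_iff (integral_exp_pos (hYe δ)).le).1 (by linarith)
  have hconv : ConvexOn ℝ Set.univ H := convexOn_integral_exp_mul hYe
  have hcont : Continuous H := continuous_mgf hYe
  have hderiv : HasDerivAt H (-ε) 0 := by
    have h := hasDerivAt_integral_mul_exp_zero (μ := μ) (w := fun _ => (1 : ℝ))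
      (v := fun ω => f ω - ε) (by fun_prop) (by fun_prop) (integrable_const 1)
      (by simpa using integrable_exp_mul_abs (hYe 2) (hYe (-2)))
    simpa [integral_sub hfi (integrable_const ε), hf0] using h
  obtain ⟨θ, hθmem, hθ⟩ := isCompact_Icc.exists_isMinOn (Set.nonempty_Icc.2 hδ.le)
    hcont.continuousOn (s := Set.Icc 0 δ)
  obtain ⟨t, ht, htδ⟩ := ((hderiv.eventually_lt_of_neg (by linarith)).and
    (Ioc_mem_nhdsGT hδ)).exists
  have hθ1 : H θ < 1 := (hθ ⟨htδ.1.le, htδ.2⟩).trans_lt (hH0 ▸ ht)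
  have hθpos : 0 < θ := hθmem.1.lt_of_ne fun h => by rw [← h, hH0] at hθ1; exact hθ1.false
  have hθlt : θ < δ := hθmem.2.lt_of_ne fun h => by rw [h] at hθ1; linarith
  have hloc : IsLocalMin H θ := hθ.isLocalMin (Icc_mem_nhds hθpos hθlt)
  refine ⟨θ, ⟨hθpos, hθlt⟩, fun η => ?_⟩
  rw [hlogH, hlogH]
  exact neg_le_neg (Real.log_le_log (integral_exp_pos (hYe θ))
    (IsMinOn.of_isLocalMin_of_convex_univ hloc hconv η))

/-- Perturbing the exponent in a direction in which the moment generating function decreases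
beats the unperturbed exponent even after paying a small linear cost. -/
lemma exists_pos_lt_sub_log_integral_exp {Ω : Type*} [MeasurableSpace Ω] {μ : Measure Ω}
    [NeZero μ] {f g : Ω → ℝ} (hf : Measurable f) (hg : Measurable g)
    (hfe : ∀ θ : ℝ, Integrable (fun ω => Real.exp (θ * f ω)) μ)
    (hge : ∀ θ : ℝ, Integrable (fun ω => Real.exp (θ * g ω)) μ) {θ : ℝ}
    (hneg : ∫ ω, Real.exp (θ * f ω) * g ω ∂μ < 0) (ε : ℝ) :
    ∃ u₀ : ℝ, 0 < u₀ ∧ ∃ t : ℝ, 0 < t ∧ ∀ u < u₀,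
      θ * ε - Real.log (∫ ω, Real.exp (θ * f ω) ∂μ) <
        θ * ε - t * u - Real.log (∫ ω, Real.exp (θ * f ω + t * g ω) ∂μ) := by
  have hgabs : ∀ c : ℝ, Integrable (fun ω => Real.exp (c * |g ω|)) μ := fun c =>
    integrable_exp_mul_abs (hge c) (hge (-c))
  have hd := hasDerivAt_integral_mul_exp_zero (μ := μ) (w := fun ω => Real.exp (θ * f ω)) (v := g)
    (by fun_prop) hg (hfe θ) (by
      simpa only [Real.abs_exp, ← Real.exp_add] using
        integrable_exp_mul_add_mul hf hg.abs hfe hgabs θ 2)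
  obtain ⟨t, ht, ht0⟩ := ((hd.eventually_lt_of_neg hneg).and self_mem_nhdsWithin).exists
  have ht0 : 0 < t := ht0
  simp only [← Real.exp_add, zero_mul, add_zero] at ht
  have hlog := Real.log_lt_log
    (integral_exp_pos (integrable_exp_mul_add_mul hf hg hfe hge θ t)) ht
  refine ⟨_, div_pos (sub_pos.2 hlog) ht0, t, ht0, fun u hu => ?_⟩
  rw [lt_div_iff₀ ht0] at hu
  linarith

lemma exists_pos_forall_integral_exp_mul_ne_zero {Ω : Type*} [MeasurableSpace Ω] {μ : Measure Ω}
    {f g : Ω → ℝ} (hf : Measurable f) (hg : Measurable g) (hgi : Integrable g μ)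
    (hfe : ∀ θ : ℝ, Integrable (fun ω => Real.exp (θ * f ω)) μ)
    (hge : ∀ θ : ℝ, Integrable (fun ω => Real.exp (θ * g ω)) μ)
    (hγ : ∫ ω, f ω * g ω ∂μ ≠ 0) :
    ∃ δ : ℝ, 0 < δ ∧ ∀ θ ∈ Set.Ioo 0 δ, ∫ ω, Real.exp (θ * f ω) * g ω ∂μ ≠ 0 := by
  have hfabs : ∀ c : ℝ, Integrable (fun ω => Real.exp (c * |f ω|)) μ := fun c =>
    integrable_exp_mul_abs (hfe c) (hfe (-c))
  have hgabs : ∀ c : ℝ, Integrable (fun ω => Real.exp (c * |g ω|)) μ := fun c =>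
    integrable_exp_mul_abs (hge c) (hge (-c))
  have hdom : Integrable (fun ω => |g ω| * Real.exp (2 * |f ω|)) μ := by
    refine (integrable_exp_mul_add_mul hg.abs hf.abs hgabs hfabs 1 2).mono' (by fun_prop)
      (ae_of_all _ fun ω => ?_)
    rw [Real.norm_of_nonneg (by positivity), one_mul, Real.exp_add]
    gcongr
    linarith [Real.add_one_le_exp |g ω|]
  have hd := hasDerivAt_integral_mul_exp_zero hg hf hgi hdom
  simp only [mul_comm (g _)] at hd
  have hev := (hd.eventually_ne (c := 0) hγ).filter_mono
    (nhdsWithin_mono (0 : ℝ) fun t (ht : 0 < t) => ht.ne')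
  obtain ⟨δ, hδ, hsub⟩ := mem_nhdsGT_iff_exists_Ioo_subset.1 hev
  exact ⟨δ, hδ, fun θ hθ => hsub hθ⟩

lemma cramerStar_le {Ω : Type*} [MeasurableSpace Ω] {Pr : Measure Ω} [NeZero Pr]
    {X : Ω → ℝ} {F : ℝ → ℝ}
    (hFexp : ∀ θ : ℝ, Integrable (fun ω => Real.exp (θ * F (X ω))) Pr) {ε c : ℝ}
    (hc : ∀ η : ℝ, η * ε - Real.log (∫ ω, Real.exp (η * F (X ω)) ∂Pr) ≤ c) :
    cramerStar Pr X F ε ≤ c := by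
  refine iSup₂_le fun η _ => ?_
  rw [ennreal_log_lintegral_exp (hFexp η)]
  exact_mod_cast hc η

lemma le_lambdaPlusStar {Ω : Type*} [MeasurableSpace Ω] {Pr : Measure Ω} [NeZero Pr]
    {X : Ω → ℝ} {F U : ℝ → ℝ} {θ t : ℝ} (hθ : 0 ≤ θ) (ht : 0 ≤ t)
    (hi : Integrable (fun ω => Real.exp (θ * F (X ω) - t * U (X ω))) Pr) (ε u : ℝ) :
    ((θ * ε - t * u - Real.log (∫ ω, Real.exp (θ * F (X ω) - t * U (X ω)) ∂Pr) : ℝ) : EReal) ≤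
      lambdaPlusStar Pr X F U ε u := by
  refine le_iSup₂_of_le θ hθ (le_iSup₂_of_le t ht ?_)
  rw [ennreal_log_lintegral_exp hi, EReal.coe_sub]

lemma le_gammaPlusStar {Ω : Type*} [MeasurableSpace Ω] {Pr : Measure Ω} [NeZero Pr]
    {X : Ω → ℝ} {F U : ℝ → ℝ} {θ t : ℝ} (hθ : 0 ≤ θ) (ht : 0 ≤ t)
    (hi : Integrable (fun ω => Real.exp (θ * F (X ω) + t * U (X ω))) Pr) (ε u : ℝ) :
    ((θ * ε - t * u - Real.log (∫ ω, Real.exp (θ * F (X ω) + t * U (X ω)) ∂Pr) : ℝ) : EReal) ≤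
      gammaPlusStar Pr X F U ε u := by
  refine le_iSup₂_of_le θ hθ (le_iSup₂_of_le t ht ?_)
  rw [ennreal_log_lintegral_exp hi, EReal.coe_sub]

/-- Theorem 4.1: if `Cov(F(X),U(X)) ≠ 0`, then for all sufficiently small `ε > 0`
and all sufficiently small `u > 0`, the screened estimator's error exponent strictly
improves on the Cramér exponent: `Δ(ε,u) > 0`. -/
theorem screening_improves_exponent
    {Ω : Type*} [MeasurableSpace Ω] (Pr : Measure Ω) [IsProbabilityMeasure Pr]
    (X : Ω → ℝ) (hXmeas : Measurable X)
    (F U : ℝ → ℝ) (hF : Measurable F) (hU : Measurable U)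
    (hFint : Integrable (fun ω => F (X ω)) Pr) (hFmean : ∫ ω, F (X ω) ∂Pr = 0)
    (hUint : Integrable (fun ω => U (X ω)) Pr) (hUmean : ∫ ω, U (X ω) ∂Pr = 0)
    (hFexp : ∀ θ : ℝ, Integrable (fun ω => Real.exp (θ * F (X ω))) Pr)
    (hUexp : ∀ θ : ℝ, Integrable (fun ω => Real.exp (θ * U (X ω))) Pr)
    (hFUint : Integrable (fun ω => F (X ω) * U (X ω)) Pr)
    (hγ : ∫ ω, F (X ω) * U (X ω) ∂Pr ≠ 0) :
    ∃ ε₀ : ℝ, 0 < ε₀ ∧ ∀ ε : ℝ, 0 < ε → ε < ε₀ →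
      ∃ u₀ : ℝ, 0 < u₀ ∧ ∀ u : ℝ, 0 < u → u < u₀ →
        0 < deltaExponent Pr X F U ε u := by
  have hf : Measurable fun ω => F (X ω) := hF.comp hXmeas
  have hg : Measurable fun ω => U (X ω) := hU.comp hXmeas
  obtain ⟨δ, hδ, hne⟩ :=
    exists_pos_forall_integral_exp_mul_ne_zero hf hg hUint hFexp hUexp hγ
  have hfne : ¬ (fun ω => F (X ω)) =ᵐ[Pr] 0 := fun h => hγ <| by
    refine integral_eq_zero_of_ae ?_
    filter_upwards [h] with ω hω
    simp only [Pi.zero_apply] at hω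
    simp [hω]
  obtain ⟨ε₀, hε₀, hmin⟩ := exists_isMinOn_integral_exp hf hFint hFmean hfne hFexp hδ
  refine ⟨ε₀, hε₀, fun ε hε hεlt => ?_⟩
  obtain ⟨θ, hθ, hopt⟩ := hmin ε hε hεlt
  have hcramer := cramerStar_le hFexp hopt
  rcases (hne θ hθ).lt_or_gt with hneg | hpos
  · obtain ⟨u₀, hu₀, t, ht, hlt⟩ :=
      exists_pos_lt_sub_log_integral_exp hf hg hFexp hUexp hneg ε
    refine ⟨u₀, hu₀, fun u _ hu => EReal.sub_pos.2 (lt_max_of_lt_right ?_)⟩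
    exact hcramer.trans_lt ((EReal.coe_lt_coe_iff.2 (hlt u hu)).trans_le
      (le_gammaPlusStar hθ.1.le ht.le (integrable_exp_mul_add_mul hf hg hFexp hUexp θ t) ε u))
  · have hUexp' : ∀ s : ℝ, Integrable (fun ω => Real.exp (s * -U (X ω))) Pr := fun s => by
      simpa only [mul_neg, neg_mul] using hUexp (-s)
    have hneg : ∫ ω, Real.exp (θ * F (X ω)) * -U (X ω) ∂Pr < 0 := by
      simpa only [mul_neg, integral_neg, neg_lt_zero] using hpos
    obtain ⟨u₀, hu₀, t, ht, hlt⟩ :=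
      exists_pos_lt_sub_log_integral_exp hf hg.neg hFexp hUexp' hneg ε
    have hi := integrable_exp_mul_add_mul hf hg.neg hFexp hUexp' θ t
    simp only [Pi.neg_apply, mul_neg, ← sub_eq_add_neg] at hlt hi
    refine ⟨u₀, hu₀, fun u _ hu => EReal.sub_pos.2 (lt_max_of_lt_left ?_)⟩
    exact hcramer.trans_lt ((EReal.coe_lt_coe_iff.2 (hlt u hu)).trans_le
      (le_lambdaPlusStar hθ.1.le ht.le hi ε u))
end
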